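/- (Theorem 4, regime 2: α-fair maximization above the critical throughput.) Let n ≥ 2, α ≥ 1, and θ ∈ (θ_n, 1), where θ_n = (1 − 1/n)^{n−1}. Then there is a unique p_s* ∈ (0, 1/n) satisfying ((n−1)·p_s*)²·(1−p_s*)^{n−2} + (1 − (n−1)·p_s*)·(1−p_s*)^{n−1} = θ. Let p* ∈ (0,1)^n be the control with n−1 components equal to p_s* and one component equal to p_l* = 1 − (n−1)·p_s*. Then T(x(p*)) = θ, and F_α(x(p*)) ≥ F_α(x(p)) for every p ∈ (0,1)^n with T(x(p)) = θ. -/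

import Mathlib

open scoped BigOperators

/-- The worst-case service rate of user `i` under control `p`. -/
noncomputable def rate {n : ℕ} (p : Fin n → ℝ) (i : Fin n) : ℝ :=
  p i * ∏ j ∈ Finset.univ.erase i, (1 - p j)

/-- The throughput of the rate vector of control `p`. -/
noncomputable def tput {n : ℕ} (p : Fin n → ℝ) : ℝ := ∑ i, rate p i

/-- The `α`-fair utility function. -/
noncomputable def Ualpha (α z : ℝ) : ℝ :=
  if α = 1 then Real.log z else z ^ (1 - α) / (1 - α)

/-- The `α`-fair objective (sum-user utility). -/
noncomputable def Falpha (α : ℝ) {n : ℕ} (x : Fin n → ℝ) : ℝ := ∑ i, Ualpha α (x i)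

/-- The critical throughput `θ_t = (1 - 1/t)^(t-1)`. -/
noncomputable def crit (t : ℕ) : ℝ := (1 - 1 / (t : ℝ)) ^ (t - 1)

/-- The control with one component `p_l = 1 - (n-1) p_s` and `n-1` components `p_s`. -/
noncomputable def qstar (n : ℕ) (ps : ℝ) : Fin n → ℝ := fun i =>
  if (i : ℕ) = 0 then 1 - ((n : ℝ) - 1) * ps else ps

lemma hasDerivAt_Ualpha (α : ℝ) {z : ℝ} (hz : 0 < z) :
    HasDerivAt (Ualpha α) (z ^ (-α)) z := by
  by_cases h : α = 1
  · have : Ualpha α = Real.log := by funext y; simp [Ualpha, h]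
    rw [this, h, Real.rpow_neg_one]
    exact Real.hasDerivAt_log hz.ne'
  · have : Ualpha α = fun y => y ^ (1 - α) / (1 - α) := by funext y; simp [Ualpha, h]
    rw [this]
    have h1 : 1 - α ≠ 0 := sub_ne_zero.2 (Ne.symm h)
    refine ((Real.hasDerivAt_rpow_const (p := 1 - α) (Or.inl hz.ne')).div_const
      (1 - α)).congr_deriv ?_
    rw [mul_div_cancel_left₀ _ h1]
    congr 1
    ring

lemma concaveOn_Ualpha {α : ℝ} (hα : 0 ≤ α) : ConcaveOn ℝ (Set.Ioi 0) (Ualpha α) := by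
  refine AntitoneOn.concaveOn_of_deriv (convex_Ioi 0)
    (fun z hz => (hasDerivAt_Ualpha α hz).continuousAt.continuousWithinAt) ?_ ?_ <;>
  rw [interior_Ioi]
  · exact fun z hz => (hasDerivAt_Ualpha α hz).differentiableAt.differentiableWithinAt
  · intro y hy z hz hyz
    rw [(hasDerivAt_Ualpha α hy).deriv, (hasDerivAt_Ualpha α hz).deriv]
    exact Real.rpow_le_rpow_of_nonpos hy hyz (by linarith)

lemma Ualpha_le_tangent {α a z : ℝ} (hα : 0 ≤ α) (ha : 0 < a) (hz : 0 < z) :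
    Ualpha α z ≤ Ualpha α a + a ^ (-α) * (z - a) := by
  have hc := concaveOn_Ualpha hα
  have hd := hasDerivAt_Ualpha α ha
  rcases lt_trichotomy z a with h | rfl | h
  · have := hc.le_slope_of_hasDerivAt hz ha h hd
    rw [slope_def_field, le_div_iff₀ (by linarith)] at this
    linarith
  · simp
  · have := hc.slope_le_of_hasDerivAt ha hz h hd
    rw [slope_def_field, div_le_iff₀ (by linarith)] at this
    linarith

/-- In the variable `u = 1 / (c + z)`, the derivative `z ^ (-α)` of the utility is convex. -/
lemma convexOn_rpow_div {α c : ℝ} (hα : 1 ≤ α) (hc : 0 < c) :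
    ConvexOn ℝ (Set.Ioo 0 (1 / c)) (fun u => (u / (1 - c * u)) ^ α) := by
  have hpos : ∀ u ∈ Set.Ioo 0 (1 / c), 0 < 1 - c * u := by
    rintro u ⟨-, h⟩
    rw [lt_div_iff₀ hc] at h
    linarith
  refine ⟨convex_Ioo _ _, fun u hu v hv s t hs ht hst => ?_⟩
  have hw : s • u + t • v ∈ Set.Ioo 0 (1 / c) := convex_Ioo 0 (1 / c) hu hv hs ht hst
  have hu' := hpos u hu
  have hv' := hpos v hv
  have hw' := hpos _ hw
  have key : (s • u + t • v) / (1 - c * (s • u + t • v))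
      ≤ s • (u / (1 - c * u)) + t • (v / (1 - c * v)) := by
    have hrec : ∀ y, 0 < 1 - c * y → y / (1 - c * y) = ((1 - c * y)⁻¹ - 1) / c := by
      intro y hy
      rw [eq_div_iff hc.ne', div_mul_eq_mul_div, div_eq_iff hy.ne', sub_mul,
        inv_mul_cancel₀ hy.ne']
      ring
    rw [hrec _ hu', hrec _ hv', hrec _ hw']
    have h := (convexOn_zpow (-1 : ℤ)).2 (Set.mem_Ioi.2 hu') (Set.mem_Ioi.2 hv') hs ht hst
    simp only [zpow_neg_one, smul_eq_mul] at h ⊢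
    have he : s * (1 - c * u) + t * (1 - c * v) = 1 - c * (s * u + t * v) := by
      linear_combination hst
    rw [he] at h
    have : s * (((1 - c * u)⁻¹ - 1) / c) + t * (((1 - c * v)⁻¹ - 1) / c)
        = (s * (1 - c * u)⁻¹ + t * (1 - c * v)⁻¹ - 1) / c := by
      linear_combination -hst / c
    rw [this]
    gcongr
  have hnu := (div_pos hu.1 hu').le
  have hnv := (div_pos hv.1 hv').le
  exact (Real.rpow_le_rpow (div_pos hw.1 hw').le key (by linarith)).trans
    ((convexOn_rpow hα).2 hnu hnv hs ht hst)

/-- Sign pattern of a convex function with two zeros. -/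
lemma ConvexOn.sign_of_two_zeros {s : Set ℝ} {g : ℝ → ℝ} (hg : ConvexOn ℝ s g) {x y : ℝ}
    (hx : x ∈ s) (hy : y ∈ s) (hxy : x < y) (hgx : g x = 0) (hgy : g y = 0) :
    (∀ u ∈ s, u ≤ x → 0 ≤ g u) ∧ (∀ u, x ≤ u → u ≤ y → g u ≤ 0) ∧
      ∀ u ∈ s, y ≤ u → 0 ≤ g u := by
  refine ⟨fun u hu hux => ?_, fun u hxu huy => ?_, fun u hu hyu => ?_⟩
  · rcases hux.eq_or_lt with rfl | hux
    · exact hgx.ge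
    have h := hg.slope_mono_adjacent hu hy hux hxy
    rw [hgx, hgy, sub_zero, zero_div, div_le_iff₀ (by linarith)] at h
    linarith
  · have h := hg.le_max_of_mem_Icc hx hy ⟨hxu, huy⟩
    simpa [hgx, hgy] using h
  · rcases hyu.eq_or_lt with rfl | hyu
    · exact hgy.ge
    have h := hg.slope_mono_adjacent hx hu hxy hyu
    rw [hgx, hgy, sub_zero, zero_div, le_div_iff₀ (by linarith)] at h
    linarith

lemma deriv_sign_of_two_zeros {α c B C a d : ℝ} (hα : 1 ≤ α) (hc : 0 < c) (ha : 0 < a)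
    (had : a < d) (hGa : a ^ (-α) - B - C / (c + a) = 0)
    (hGd : d ^ (-α) - B - C / (c + d) = 0) :
    (∀ z, 0 < z → z ≤ a → 0 ≤ z ^ (-α) - B - C / (c + z)) ∧
      (∀ z, a ≤ z → z ≤ d → z ^ (-α) - B - C / (c + z) ≤ 0) ∧
      ∀ z, d ≤ z → 0 ≤ z ^ (-α) - B - C / (c + z) := by
  let g : ℝ → ℝ := fun u => (u / (1 - c * u)) ^ α - B - C * u
  have hg : ConvexOn ℝ (Set.Ioo 0 (1 / c)) g := by
    refine ⟨convex_Ioo _ _, fun u hu v hv s t hs ht hst => ?_⟩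
    have h := (convexOn_rpow_div hα hc).2 hu hv hs ht hst
    simp only [smul_eq_mul, g] at h ⊢
    have hB : B = s * B + t * B := by rw [← add_mul, hst, one_mul]
    linarith
  have hmem : ∀ z, 0 < z → 1 / (c + z) ∈ Set.Ioo 0 (1 / c) := fun z hz =>
    ⟨by positivity, one_div_lt_one_div_of_lt hc (by linarith)⟩
  have hval : ∀ z, 0 < z → g (1 / (c + z)) = z ^ (-α) - B - C / (c + z) := by
    intro z hz
    have h1 : 1 / (c + z) / (1 - c * (1 / (c + z))) = z⁻¹ := by
      have : 1 - c * (1 / (c + z)) = z / (c + z) := by field_simp; ring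
      rw [this]
      field_simp
    simp only [g]
    rw [h1, Real.inv_rpow hz.le, Real.rpow_neg hz.le]
    ring
  have hmono : ∀ y z, 0 < y → y ≤ z → 1 / (c + z) ≤ 1 / (c + y) := fun y z hy hyz =>
    one_div_le_one_div_of_le (by linarith) (by linarith)
  have hd : 0 < d := ha.trans had
  obtain ⟨h1, h2, h3⟩ := hg.sign_of_two_zeros (hmem d hd) (hmem a ha)
    (one_div_lt_one_div_of_lt (by linarith) (by linarith))
    ((hval d hd).trans hGd) ((hval a ha).trans hGa)
  refine ⟨fun z hz hza => ?_, fun z haz hzd => ?_, fun z hdz => ?_⟩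
  · rw [← hval z hz]
    exact h3 _ (hmem z hz) (hmono _ _ hz hza)
  · have hz := ha.trans_le haz
    rw [← hval z hz]
    exact h2 _ (hmono _ _ hz hzd) (hmono _ _ ha haz)
  · have hz := hd.trans_le hdz
    rw [← hval z hz]
    exact h1 _ (hmem z hz) (hmono _ _ hd hdz)

/-- A majorant of the utility on `(0, b]`, touching it at `a` to second order and at `b`. -/
lemma exists_Ualpha_majorant {α c a b : ℝ} (hα : 1 ≤ α) (hc : 0 < c) (ha : 0 < a)
    (hab : a < b) :
    ∃ C, 0 ≤ C ∧
      Ualpha α b = Ualpha α a + a ^ (-α) * (b - a)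
        + C * (Real.log (c + b) - Real.log (c + a) - (b - a) / (c + a)) ∧
      ∀ z, 0 < z → z ≤ b → Ualpha α z ≤ Ualpha α a + a ^ (-α) * (z - a)
        + C * (Real.log (c + z) - Real.log (c + a) - (z - a) / (c + a)) := by
  have hb : 0 < b := ha.trans hab
  set D := Real.log (c + b) - Real.log (c + a) - (b - a) / (c + a) with hD
  have hDneg : D < 0 := by
    have h1 : Real.log ((c + b) / (c + a)) < (c + b) / (c + a) - 1 :=
      Real.log_lt_sub_one_of_pos (by positivity) (by
        intro h
        rw [div_eq_one_iff_eq (by positivity)] at h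
        linarith)
    rw [Real.log_div (by positivity) (by positivity)] at h1
    have h2 : (c + b) / (c + a) - 1 = (b - a) / (c + a) := by field_simp; ring
    linarith
  set C := (Ualpha α b - Ualpha α a - a ^ (-α) * (b - a)) / D
  have hCD : C * D = Ualpha α b - Ualpha α a - a ^ (-α) * (b - a) :=
    div_mul_cancel₀ _ hDneg.ne
  let ψ : ℝ → ℝ := fun z => Ualpha α z - (Ualpha α a + a ^ (-α) * (z - a)
    + C * (Real.log (c + z) - Real.log (c + a) - (z - a) / (c + a)))
  set B := a ^ (-α) - C / (c + a) with hB
  let ψ' : ℝ → ℝ := fun z => z ^ (-α) - B - C / (c + z)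
  have hψ : ∀ z, 0 < z → HasDerivAt ψ (ψ' z) z := by
    intro z hz
    have hl : HasDerivAt (fun z => Real.log (c + z)) (1 / (c + z)) z :=
      ((hasDerivAt_id z).const_add c).log (by simp only [id]; positivity)
    have hs : HasDerivAt (fun z => z - a) 1 z := (hasDerivAt_id z).sub_const a
    have h := (hasDerivAt_Ualpha α hz).sub
      (((hs.const_mul (a ^ (-α))).const_add (Ualpha α a)).add
        (((hl.sub_const (Real.log (c + a))).sub (hs.div_const (c + a))).const_mul C))
    refine h.congr_deriv ?_
    simp only [ψ', hB]
    ring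
  have hψa : ψ a = 0 := by simp [ψ]
  have hψb : ψ b = 0 := by
    simp only [ψ]
    rw [← hD, hCD]
    ring
  have hcont : ∀ z, 0 < z → ContinuousAt ψ z := fun z hz => (hψ z hz).continuousAt
  obtain ⟨d, ⟨had, hdb⟩, hd0⟩ := exists_hasDerivAt_eq_zero hab
    (fun z hz => (hcont z (ha.trans_le hz.1)).continuousWithinAt) (hψa.trans hψb.symm)
    (fun z hz => hψ z (ha.trans hz.1))
  have ha0 : a ^ (-α) - B - C / (c + a) = 0 := by rw [hB]; ring
  obtain ⟨h1, h2, h3⟩ := deriv_sign_of_two_zeros hα hc ha had ha0 hd0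
  refine ⟨C, div_nonneg_of_nonpos ?_ hDneg.le, by rw [hCD]; ring, fun z hz hzb => ?_⟩
  · have := Ualpha_le_tangent (by linarith : 0 ≤ α) ha hb
    linarith
  suffices h : ψ z ≤ 0 by
    simp only [ψ] at h
    linarith
  rcases le_total z a with hza | haz
  · have hm : MonotoneOn ψ (Set.Icc z a) := by
      refine monotoneOn_of_hasDerivWithinAt_nonneg (f' := ψ') (convex_Icc _ _)
        (fun y hy => (hcont y (hz.trans_le hy.1)).continuousWithinAt) ?_ ?_ <;>
      rw [interior_Icc] <;> intro y hy
      · exact (hψ y (hz.trans hy.1)).hasDerivWithinAt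
      · exact h1 y (hz.trans hy.1) hy.2.le
    exact (hm (Set.left_mem_Icc.2 hza) (Set.right_mem_Icc.2 hza) hza).trans hψa.le
  rcases le_total z d with hzd | hdz
  · have hm : AntitoneOn ψ (Set.Icc a z) := by
      refine antitoneOn_of_hasDerivWithinAt_nonpos (f' := ψ') (convex_Icc _ _)
        (fun y hy => (hcont y (ha.trans_le hy.1)).continuousWithinAt) ?_ ?_ <;>
      rw [interior_Icc] <;> intro y hy
      · exact (hψ y (ha.trans hy.1)).hasDerivWithinAt
      · exact h2 y hy.1.le (hy.2.le.trans hzd)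
    exact (hm (Set.left_mem_Icc.2 haz) (Set.right_mem_Icc.2 haz) haz).trans hψa.le
  · have hm : MonotoneOn ψ (Set.Icc z b) := by
      refine monotoneOn_of_hasDerivWithinAt_nonneg (f' := ψ') (convex_Icc _ _)
        (fun y hy => (hcont y (hz.trans_le hy.1)).continuousWithinAt) ?_ ?_ <;>
      rw [interior_Icc] <;> intro y hy
      · exact (hψ y (hz.trans hy.1)).hasDerivWithinAt
      · exact h3 y (hdz.trans hy.1.le)
    exact (hm (Set.left_mem_Icc.2 hzb) (Set.right_mem_Icc.2 hzb) hzb).trans hψb.le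

/-- Among positive vectors with prescribed sum and bounded `∑ log (c + x i)`, the utility is
largest when all entries but one, the largest, agree. -/
lemma sum_Ualpha_le {n : ℕ} {α c a b : ℝ} (hα : 1 ≤ α) (hc : 0 < c) (ha : 0 < a)
    (hab : a < b) {x : Fin n → ℝ} (hx : ∀ i, 0 < x i)
    (hsum : ∑ i, x i = ((n : ℝ) - 1) * a + b)
    (hlog : ∑ i, Real.log (c + x i) ≤ ((n : ℝ) - 1) * Real.log (c + a) + Real.log (c + b)) :
    ∑ i, Ualpha α (x i) ≤ ((n : ℝ) - 1) * Ualpha α a + Ualpha α b := by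
  have hα0 : 0 ≤ α := by linarith
  by_cases hmax : ∀ i, x i ≤ b
  · obtain ⟨C, hC, hCb, hCz⟩ := exists_Ualpha_majorant hα hc ha hab
    have h := Finset.sum_le_sum fun i (_ : i ∈ Finset.univ) => hCz (x i) (hx i) (hmax i)
    simp only [Finset.sum_add_distrib, ← Finset.mul_sum, Finset.sum_sub_distrib,
      ← Finset.sum_div, Finset.sum_const, Finset.card_univ, Fintype.card_fin, nsmul_eq_mul,
      hsum] at h
    have h2 := mul_le_mul_of_nonneg_left hlog hC
    have h3 : (((n : ℝ) - 1) * a + b - n * a) / (c + a) = (b - a) / (c + a) := by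
      congr 1; ring
    rw [h3] at h
    linarith
  · push Not at hmax
    obtain ⟨j, hj⟩ := hmax
    have hb : 0 < b := ha.trans hab
    have hslope : b ^ (-α) * (x j - b) ≤ a ^ (-α) * (x j - b) :=
      mul_le_mul_of_nonneg_right (Real.rpow_le_rpow_of_nonpos ha hab.le (by linarith))
        (by linarith)
    have hUj := Ualpha_le_tangent hα0 hb (hx j)
    have hrest := Finset.sum_le_sum fun i (_ : i ∈ Finset.univ.erase j) =>
      Ualpha_le_tangent hα0 ha (hx i)
    have hcard : ((Finset.univ.erase j).card : ℝ) = (n : ℝ) - 1 := by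
      rw [Finset.cast_card_erase_of_mem (Finset.mem_univ j)]
      simp
    simp only [Finset.sum_add_distrib, ← Finset.mul_sum, Finset.sum_sub_distrib,
      Finset.sum_const, nsmul_eq_mul, hcard] at hrest
    have e1 := Finset.add_sum_erase Finset.univ x (Finset.mem_univ j)
    have e2 := Finset.add_sum_erase Finset.univ (fun i => Ualpha α (x i)) (Finset.mem_univ j)
    have e3 : ∑ i ∈ Finset.univ.erase j, x i = ((n : ℝ) - 1) * a + b - x j := by linarith
    rw [e3] at hrest
    linarith

lemma rate_eq_odds_mul {n : ℕ} {p : Fin n → ℝ} (hp : ∀ i, p i < 1) (i : Fin n) :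
    rate p i = p i / (1 - p i) * ∏ j, (1 - p j) := by
  have : 1 - p i ≠ 0 := (sub_pos.2 (hp i)).ne'
  rw [rate, ← Finset.mul_prod_erase Finset.univ (fun j => 1 - p j) (Finset.mem_univ i)]
  field_simp

lemma rate_pos {n : ℕ} {p : Fin n → ℝ} (hp : ∀ i, p i ∈ Set.Ioo (0 : ℝ) 1) (i : Fin n) :
    0 < rate p i :=
  mul_pos (hp i).1 (Finset.prod_pos fun j _ => sub_pos.2 (hp j).2)

lemma sum_log_prod_add_rate {n : ℕ} {p : Fin n → ℝ} (hp : ∀ i, p i < 1) :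
    ∑ i, Real.log (∏ j, (1 - p j) + rate p i)
      = ((n : ℝ) - 1) * Real.log (∏ j, (1 - p j)) := by
  have hpos : ∀ i, 0 < 1 - p i := fun i => sub_pos.2 (hp i)
  have hP : 0 < ∏ j, (1 - p j) := Finset.prod_pos fun j _ => hpos j
  have h : ∀ i, Real.log (∏ j, (1 - p j) + rate p i)
      = Real.log (∏ j, (1 - p j)) - Real.log (1 - p i) := by
    intro i
    rw [← Real.log_div hP.ne' (hpos i).ne', rate_eq_odds_mul hp]
    congr 1
    have := (hpos i).ne'
    field_simp
    ring
  simp only [h, Finset.sum_sub_distrib, Finset.sum_const, Finset.card_univ, Fintype.card_fin,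
    nsmul_eq_mul]
  rw [← Real.log_prod fun i _ => (hpos i).ne']
  ring

/-- Weighted AM-GM: a control with `∑ q i = 1` gives a Pareto optimal rate vector. -/
lemma mul_log_le_sum_log_add_rate {n : ℕ} {q : Fin n → ℝ}
    (hq : ∀ i, q i ∈ Set.Ioo (0 : ℝ) 1) (hsum : ∑ i, q i = 1) {c : ℝ} (hc : 0 < c) :
    ((n : ℝ) - 1) * Real.log c ≤ ∑ i, Real.log (c + rate q i) := by
  have hpos : ∀ i, 0 < 1 - q i := fun i => sub_pos.2 (hq i).2
  have hP : 0 < ∏ j, (1 - q j) := Finset.prod_pos fun j _ => hpos j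
  set P := ∏ j, (1 - q j) with hPdef
  have h : ∀ i, (1 - q i) * Real.log c + q i * Real.log P - Real.log (1 - q i)
      ≤ Real.log (c + rate q i) := by
    intro i
    have h1 := strictConcaveOn_log_Ioi.concaveOn.2 (Set.mem_Ioi.2 (div_pos hc (hpos i)))
      (Set.mem_Ioi.2 (div_pos hP (hpos i))) (hpos i).le (hq i).1.le (by ring)
    simp only [smul_eq_mul] at h1
    rw [Real.log_div hc.ne' (hpos i).ne', Real.log_div hP.ne' (hpos i).ne'] at h1
    have h2 : (1 - q i) * (c / (1 - q i)) + q i * (P / (1 - q i)) = c + rate q i := by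
      rw [rate_eq_odds_mul (fun i => (hq i).2), mul_div_cancel₀ _ (hpos i).ne']
      ring
    rw [h2] at h1
    linarith
  refine le_trans (le_of_eq ?_) (Finset.sum_le_sum fun i _ => h i)
  rw [Finset.sum_sub_distrib, Finset.sum_add_distrib, ← Finset.sum_mul, ← Finset.sum_mul,
    hsum, ← Real.log_prod fun i _ => (hpos i).ne', ← hPdef, Finset.sum_sub_distrib, hsum]
  simp

/-- The throughput of the control `qstar (k + 2) s` is strictly decreasing in `s`. -/
lemma strictAntiOn_throughput (k : ℕ) :
    StrictAntiOn (fun s : ℝ => ((k + 1) * s) ^ 2 * (1 - s) ^ k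
      + (1 - (k + 1) * s) * (1 - s) ^ (k + 1)) (Set.Icc 0 (1 / (k + 2))) := by
  have hk : (0 : ℝ) < k + 2 := by positivity
  have hform : (fun s : ℝ => ((k + 1) * s) ^ 2 * (1 - s) ^ k
      + (1 - (k + 1) * s) * (1 - s) ^ (k + 1))
      = fun s : ℝ => (1 - s) ^ k * ((k + 1) * (k + 2) * s ^ 2 - (k + 2) * s + 1) := by
    funext s; ring
  rw [hform]
  refine strictAntiOn_of_hasDerivWithinAt_neg
    (f' := fun s => (k * (1 - s) ^ (k - 1) * (-1))
        * ((k + 1) * (k + 2) * s ^ 2 - (k + 2) * s + 1)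
      + (1 - s) ^ k * ((k + 1) * (k + 2) * (2 * s) - (k + 2)))
    (convex_Icc _ _) (by fun_prop) ?_ ?_ <;> rw [interior_Icc] <;> intro s hs
  · have h1 : HasDerivAt (fun s : ℝ => 1 - s) (-1) s := (hasDerivAt_id s).const_sub 1
    have h2 : HasDerivAt (fun s : ℝ => s ^ 2) (2 * s) s := by
      simpa using hasDerivAt_pow 2 s
    have h3 : HasDerivAt (fun s : ℝ => (k + 2) * s) ((k + 2 : ℝ)) s := by
      simpa using (hasDerivAt_id s).const_mul (k + 2 : ℝ)
    exact ((h1.fun_pow k).mul (((h2.const_mul _).sub h3).add_const 1)).hasDerivWithinAt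
  · obtain ⟨hs0, hs1⟩ := hs
    rw [lt_div_iff₀ hk] at hs1
    have hs2 : 0 < 1 - s := by nlinarith [(Nat.cast_nonneg k : (0 : ℝ) ≤ k)]
    have hpw : (k : ℝ) * (1 - s) ^ (k - 1) * (1 - s) = k * (1 - s) ^ k := by
      rcases k with _ | k
      · simp
      · rw [Nat.add_sub_cancel, mul_assoc, ← pow_succ]
    refine neg_of_mul_neg_left (b := 1 - s) ?_ hs2.le
    have : ((k * (1 - s) ^ (k - 1) * (-1)) * ((k + 1) * (k + 2) * s ^ 2 - (k + 2) * s + 1)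
        + (1 - s) ^ k * ((k + 1) * (k + 2) * (2 * s) - (k + 2))) * (1 - s)
        = -((1 - s) ^ k * (k + 1) * ((1 - s * (k + 2)) * (2 - s * (k + 2)))) := by
      linear_combination (-((k + 1) * (k + 2) * s ^ 2 - (k + 2) * s + 1)) * hpw
    rw [this, neg_lt_zero]
    have h1 : 0 < 1 - s * (k + 2) := by linarith
    have h2 : 0 < 2 - s * (k + 2) := by linarith
    positivity

lemma existsUnique_throughput_eq (k : ℕ) {θ : ℝ} (hθ1 : crit (k + 2) < θ) (hθ2 : θ < 1) :
    ∃! s : ℝ, s ∈ Set.Ioo (0 : ℝ) (1 / (k + 2)) ∧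
      ((k + 1) * s) ^ 2 * (1 - s) ^ k + (1 - (k + 1) * s) * (1 - s) ^ (k + 1) = θ := by
  have hk : (0 : ℝ) < k + 2 := by positivity
  have hanti := strictAntiOn_throughput k
  set f : ℝ → ℝ := fun s => ((k + 1) * s) ^ 2 * (1 - s) ^ k
      + (1 - (k + 1) * s) * (1 - s) ^ (k + 1) with hf
  have hcont : ContinuousOn f (Set.Icc 0 (1 / (k + 2))) := by fun_prop
  have hmem : θ ∈ Set.Ioo (f (1 / (k + 2))) (f 0) := by
    refine ⟨lt_of_eq_of_lt ?_ hθ1, by simpa [f] using hθ2⟩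
    have h : (k + 1) * (1 / ((k : ℝ) + 2)) = 1 - 1 / (k + 2) := by field_simp; ring
    simp only [f, crit, h]
    push_cast
    ring
  obtain ⟨s, hs, hsθ⟩ := intermediate_value_Ioo' (by positivity : (0 : ℝ) ≤ 1 / (k + 2)) hcont hmem
  refine ⟨s, ⟨hs, hsθ⟩, fun t ⟨ht, htθ⟩ => ?_⟩
  exact hanti.injOn (Set.Ioo_subset_Icc_self ht) (Set.Ioo_subset_Icc_self hs)
    (htθ.trans hsθ.symm)

theorem alpha_fair_regime_two (n : ℕ) (hn : 2 ≤ n) (α : ℝ) (hα : 1 ≤ α)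
    (θ : ℝ) (hθ1 : crit n < θ) (hθ2 : θ < 1) :
    (∃! ps : ℝ, ps ∈ Set.Ioo (0:ℝ) (1 / (n : ℝ)) ∧
      (((n : ℝ) - 1) * ps) ^ 2 * (1 - ps) ^ (n - 2) +
        (1 - ((n : ℝ) - 1) * ps) * (1 - ps) ^ (n - 1) = θ) ∧
    ∀ ps : ℝ, ps ∈ Set.Ioo (0:ℝ) (1 / (n : ℝ)) →
      (((n : ℝ) - 1) * ps) ^ 2 * (1 - ps) ^ (n - 2) +
        (1 - ((n : ℝ) - 1) * ps) * (1 - ps) ^ (n - 1) = θ →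
      (tput (qstar n ps) = θ ∧
       ∀ p : Fin n → ℝ, (∀ i, p i ∈ Set.Ioo (0:ℝ) 1) → tput p = θ →
         Falpha α (fun i => rate p i) ≤ Falpha α (fun i => rate (qstar n ps) i)) := by

  obtain ⟨k, rfl⟩ := Nat.exists_eq_add_of_le' hn
  have e1 : k + 2 - 2 = k := rfl
  have e2 : k + 2 - 1 = k + 1 := rfl
  have e3 : ((k + 2 : ℕ) : ℝ) = k + 2 := by push_cast; ring
  have e4 : (k : ℝ) + 2 - 1 = k + 1 := by ring
  simp only [e1, e2, e3, e4]
  refine ⟨existsUnique_throughput_eq k hθ1 hθ2, fun s hs hsθ => ?_⟩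
  obtain ⟨hs0, hs1⟩ := hs
  rw [lt_div_iff₀ (by positivity)] at hs1
  have hk : (0 : ℝ) ≤ k := Nat.cast_nonneg k
  have hs2 : 0 < 1 - s := by nlinarith
  have hq0 : qstar (k + 2) s 0 = 1 - (k + 1) * s := by
    simp only [qstar, e3, e4, Fin.val_zero, if_true]
  have hqs : ∀ i : Fin (k + 1), qstar (k + 2) s i.succ = s := fun i => by simp [qstar]
  have hq : ∀ i, qstar (k + 2) s i ∈ Set.Ioo (0 : ℝ) 1 := by
    refine Fin.cases ?_ fun i => ?_
    · rw [hq0]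
      constructor <;> nlinarith
    · rw [hqs]
      exact ⟨hs0, by linarith⟩
  have hq1 : ∑ i, qstar (k + 2) s i = 1 := by
    rw [Fin.sum_univ_succ, hq0]
    simp [hqs]
  have hP : ∏ j, (1 - qstar (k + 2) s j) = (k + 1) * s * (1 - s) ^ (k + 1) := by
    rw [Fin.prod_univ_succ, hq0]
    simp [hqs]
  have hl : rate (qstar (k + 2) s) 0 = (1 - (k + 1) * s) * (1 - s) ^ (k + 1) := by
    rw [rate_eq_odds_mul (fun i => (hq i).2), hP, hq0]
    have : (k + 1) * s ≠ 0 := by positivity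
    rw [sub_sub_cancel]
    field_simp
  have hr : ∀ i : Fin (k + 1),
      rate (qstar (k + 2) s) i.succ = (k + 1) * s ^ 2 * (1 - s) ^ k := by
    intro i
    rw [rate_eq_odds_mul (fun i => (hq i).2), hP, hqs, pow_succ]
    field_simp
  have hsplit : ∀ g : ℝ → ℝ, ∑ i, g (rate (qstar (k + 2) s) i)
      = (((k + 2 : ℕ) : ℝ) - 1) * g ((k + 1) * s ^ 2 * (1 - s) ^ k)
        + g ((1 - (k + 1) * s) * (1 - s) ^ (k + 1)) := by
    intro g
    rw [Fin.sum_univ_succ, hl, e3, e4]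
    simp [hr, add_comm]
  have ht : tput (qstar (k + 2) s) = θ := by
    rw [tput, hsplit fun x => x, ← hsθ, e3]
    ring
  refine ⟨ht, fun p hp hpθ => ?_⟩
  have hc : 0 < ∏ j, (1 - p j) := Finset.prod_pos fun j _ => sub_pos.2 (hp j).2
  rw [Falpha, Falpha, hsplit (Ualpha α)]
  refine sum_Ualpha_le hα hc (by positivity) ?_ (rate_pos hp) ?_ ?_
  · have h : (k + 1) * s ^ 2 < (1 - (k + 1) * s) * (1 - s) := by nlinarith
    calc _ < (1 - (k + 1) * s) * (1 - s) * (1 - s) ^ k :=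
          mul_lt_mul_of_pos_right h (pow_pos hs2 k)
      _ = _ := by ring
  · rw [← hsplit fun x => x]
    exact hpθ.trans ht.symm
  · rw [← hsplit fun x => Real.log (∏ j, (1 - p j) + x),
      sum_log_prod_add_rate fun i => (hp i).2]
    exact mul_log_le_sum_log_add_rate hq hq1 hc
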